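/- Let μ be the logistic probability measure on ℝ (with distribution function F(x) = 1/(1+e^{-x})), let δ ≠ 0 be real, and set θ = e^δ/(1+e^δ). Then the pushforward of μ under the map x ↦ |x+δ| equals the mixture measure Σ_{n=1}^∞ (θ(1-θ)^n + (1-θ)θ^n) · ν_n, where for each n ∈ ℕ, ν_n is the probability measure on (0,∞) with density x ↦ n e^{-x} (1-e^{-x})^{n-1} (the law of the maximum of n i.i.d. standard exponential random variables). -/

import Mathlib

open MeasureTheory Real

/-- The logistic probability measure on ℝ, with distribution function `x ↦ 1/(1+e^{-x})`
and hence density `x ↦ e^{-x}/(1+e^{-x})²`. -/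
noncomputable def logisticMeasure : Measure ℝ :=
  volume.withDensity fun x => ENNReal.ofReal (Real.exp (-x) / (1 + Real.exp (-x)) ^ 2)

/-- The law of the maximum of `n` i.i.d. standard exponential random variables:
the measure on `(0,∞)` with density `x ↦ n e^{-x} (1-e^{-x})^{n-1}`. -/
noncomputable def maxExpMeasure (n : ℕ) : Measure ℝ :=
  volume.withDensity fun x =>
    ENNReal.ofReal (if 0 < x then n * Real.exp (-x) * (1 - Real.exp (-x)) ^ (n - 1) else 0)

open Set in
/-- The image of an absolutely continuous measure on `ℝ` under `x ↦ |x + δ|`. -/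
theorem map_abs_add_withDensity {f : ℝ → ENNReal} (hf : Measurable f) (δ : ℝ) :
    (volume.withDensity f).map (fun x : ℝ => |x + δ|) =
      volume.withDensity ((Ioi 0).indicator fun x => f (x - δ) + f (-x - δ)) := by
  have hm : Measurable fun x : ℝ => |x + δ| := by fun_prop
  ext s hs
  set g : ℝ → ENNReal := fun x => ((fun x : ℝ => |x + δ|) ⁻¹' s).indicator f (x - δ) with hg
  have hgm : Measurable g := (hf.indicator (hm hs)).comp (measurable_id.sub_const δ)
  have hneg : ∫⁻ x in Iic 0, g x = ∫⁻ x in Ioi 0, g (-x) := by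
    rw [← (Measure.measurePreserving_neg (volume : Measure ℝ)).setLIntegral_comp_preimage
      measurableSet_Iic hgm]
    simpa using setLIntegral_congr (f := fun x => g (-x)) Ioi_ae_eq_Ici.symm
  rw [Measure.map_apply hm hs, withDensity_apply _ (hm hs), withDensity_apply _ hs,
    ← lintegral_indicator (hm hs), ← lintegral_sub_right_eq_self _ δ]
  change ∫⁻ x, g x = _
  rw [← lintegral_add_compl g measurableSet_Ioi, compl_Ioi, hneg, ← lintegral_add_left hgm,
    ← lintegral_indicator measurableSet_Ioi, ← lintegral_indicator hs]
  congr 1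
  ext x
  by_cases hx : 0 < x <;> by_cases hxs : x ∈ s <;>
    simp [hg, indicator, hx, hxs, abs_of_pos]

/-- The series `∑ (n + 1) p q ^ (n + 1) t u ^ n` of mixture densities, summed. -/
theorem hasSum_geometric_mixture {p q t u : ℝ} (h : |q * u| < 1) :
    HasSum (fun n : ℕ => p * q ^ (n + 1) * (((n + 1 : ℕ) : ℝ) * t * u ^ n))
      (p * q * t / (1 - q * u) ^ 2) := by
  have h1 : HasSum (fun n : ℕ => ((n + 1).choose 1 : ℝ) * (q * u) ^ n) (1 / (1 - q * u) ^ 2) := by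
    simpa using hasSum_choose_mul_geometric_of_norm_lt_one 1 (r := q * u) h
  rw [div_eq_mul_one_div]
  convert h1.mul_left (p * q * t) using 1
  · rfl
  · ext n
    rw [Nat.choose_one_right]
    ring

/-- The density of `|x + δ|` as a mixture of densities of maxima of exponentials. -/
theorem hasSum_logistic_density (δ : ℝ) {x : ℝ} (hx : 0 < x) :
    HasSum (fun n : ℕ =>
      ((exp δ / (1 + exp δ)) * (1 - exp δ / (1 + exp δ)) ^ (n + 1) +
        (1 - exp δ / (1 + exp δ)) * (exp δ / (1 + exp δ)) ^ (n + 1)) *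
        (((n + 1 : ℕ) : ℝ) * exp (-x) * (1 - exp (-x)) ^ n))
      (exp (-(x - δ)) / (1 + exp (-(x - δ))) ^ 2 +
        exp (-(-x - δ)) / (1 + exp (-(-x - δ))) ^ 2) := by
  have hd := exp_pos δ
  have ht := exp_pos (-x)
  have ht1 : exp (-x) < 1 := by simpa using hx
  have hinv : exp x = (exp (-x))⁻¹ := by rw [exp_neg, inv_inv]
  have e1 : exp (-(x - δ)) = exp (-x) * exp δ := by rw [← exp_add]; ring_nf
  have e2 : exp (-(-x - δ)) = (exp (-x))⁻¹ * exp δ := by rw [← hinv, ← exp_add]; ring_nf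
  rw [e1, e2]
  generalize exp (-x) = t at *
  generalize exp δ = d at *
  have hq : 1 - d / (1 + d) = 1 / (1 + d) := by field_simp; ring
  rw [hq]
  have key : ∀ q : ℝ, 0 < q → q < 1 → |q * (1 - t)| < 1 := fun q h0 h1 => by
    rw [abs_lt]
    constructor <;> nlinarith
  have hp0 : 0 < d / (1 + d) := by positivity
  have hq0 : 0 < 1 / (1 + d) := by positivity
  have hp1 : d / (1 + d) < 1 := by linarith
  have hq1 : 1 / (1 + d) < 1 := by linarith
  convert (hasSum_geometric_mixture (p := d / (1 + d)) (t := t) (key _ hq0 hq1)).add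
    (hasSum_geometric_mixture (p := 1 / (1 + d)) (t := t) (key _ hp0 hp1)) using 1
  · ext n
    ring
  · have a1 : 1 - 1 / (1 + d) * (1 - t) = (d + t) / (1 + d) := by field_simp; ring
    have a2 : 1 - d / (1 + d) * (1 - t) = (1 + t * d) / (1 + d) := by field_simp; ring
    have a3 : 1 + t⁻¹ * d = (d + t) / t := by field_simp; ring
    rw [a1, a2, a3]
    field_simp
    ring

/-- The pushforward of the logistic measure under `x ↦ |x+δ|` is the mixture
`Σ_{n=1}^∞ (θ(1-θ)^n + (1-θ)θ^n) ν_n` of the laws `ν_n` of maxima of `n` i.i.d.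
standard exponentials, where `θ = e^δ/(1+e^δ)`. -/
theorem logistic_noncentral_mixture_measure (δ : ℝ) (hδ : δ ≠ 0) :
    logisticMeasure.map (fun x : ℝ => |x + δ|) =
      Measure.sum (fun n : ℕ =>
        ENNReal.ofReal
            ((Real.exp δ / (1 + Real.exp δ)) * (1 - Real.exp δ / (1 + Real.exp δ)) ^ (n + 1) +
              (1 - Real.exp δ / (1 + Real.exp δ)) * (Real.exp δ / (1 + Real.exp δ)) ^ (n + 1)) •
          maxExpMeasure (n + 1)) := by
  have hpq : 0 ≤ 1 - exp δ / (1 + exp δ) := by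
    rw [sub_nonneg, div_le_one (by positivity)]
    linarith
  have hm (n : ℕ) : Measurable fun x : ℝ => ENNReal.ofReal
      (if 0 < x then n * exp (-x) * (1 - exp (-x)) ^ (n - 1) else 0) :=
    (Measurable.ite measurableSet_Ioi (by fun_prop) measurable_const).ennreal_ofReal
  rw [logisticMeasure, map_abs_add_withDensity (by fun_prop)]
  simp_rw [maxExpMeasure, ← withDensity_smul _ (hm _)]
  rw [← withDensity_tsum fun n => (hm _).const_smul _]
  congr 1
  ext x
  rw [tsum_apply (Pi.summable.2 fun _ => ENNReal.summable)]
  by_cases hx : 0 < x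
  · have hu : 0 ≤ 1 - exp (-x) := by simpa using hx.le
    have hs := hasSum_logistic_density δ hx
    rw [Set.indicator_of_mem (Set.mem_Ioi.2 hx),
      ← ENNReal.ofReal_add (by positivity) (by positivity), ← hs.tsum_eq,
      ENNReal.ofReal_tsum_of_nonneg (fun n => by positivity) hs.summable]
    refine tsum_congr fun n => ?_
    rw [ENNReal.ofReal_mul (by positivity)]
    simp [hx]
  · simp [hx]
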